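/- Let μ ∈ ℝ^d, let Ω be a symmetric positive-definite d×d matrix with ω = diag(Ω)^{1/2} and Ω̄ = ω⁻¹Ωω⁻¹, and let α ∈ ℝ^d, τ, κ ∈ ℝ, ν > 0. Then, writing z = ω⁻¹(y − μ), ∫_{ℝ^d} ψ_d(y − μ; Ω, ν) Ψ( (αᵀz + τ) √((ν+d)/(ν + zᵀΩ̄⁻¹z)); κ, ν+d ) dy = Ψ( τ/√(1 + αᵀΩ̄α); κ/√(1 + αᵀΩ̄α), ν ). Equivalently, the non-central extended skew-t density ψ_d(y; μ, Ω, α, τ, κ, ν) integrates to one over ℝ^d. -/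

import Mathlib

open MeasureTheory Real Filter Matrix Set Topology Asymptotics

noncomputable section

/-- Standard normal density. -/
def nPdf (x : ℝ) : ℝ := (Real.sqrt (2 * π))⁻¹ * Real.exp (-(x ^ 2) / 2)

/-- Standard normal distribution function. -/
def nCdf (x : ℝ) : ℝ := ∫ u in Set.Iio x, nPdf u

/-- Centred multivariate normal density with covariance matrix `S`. -/
def mvnPdf {ι : Type*} [Fintype ι] [DecidableEq ι] (S : Matrix ι ι ℝ) (y : ι → ℝ) : ℝ :=
  (2 * π) ^ (-(Fintype.card ι : ℝ) / 2) * S.det ^ (-(1 : ℝ) / 2) *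
    Real.exp (-(y ⬝ᵥ S⁻¹.mulVec y) / 2)

/-- Centred multivariate normal distribution function. -/
def mvnCdf {ι : Type*} [Fintype ι] [DecidableEq ι] (S : Matrix ι ι ℝ) (w : ι → ℝ) : ℝ :=
  ∫ u in Set.univ.pi fun i => Set.Iic (w i), mvnPdf S u

/-- Multivariate central Student-t density with scale matrix `S` and `ν` degrees of freedom. -/
def tPdf {ι : Type*} [Fintype ι] [DecidableEq ι] (S : Matrix ι ι ℝ) (ν : ℝ) (y : ι → ℝ) : ℝ :=
  Real.Gamma ((ν + Fintype.card ι) / 2) *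
      (1 + y ⬝ᵥ S⁻¹.mulVec y / ν) ^ (-(ν + Fintype.card ι) / 2) /
    (Real.Gamma (ν / 2) * (ν * π) ^ ((Fintype.card ι : ℝ) / 2) * Real.sqrt S.det)

/-- Univariate non-central t distribution function with non-centrality `a`. -/
def nctCdf (x a ν : ℝ) : ℝ :=
  ∫ v in Set.Ioi (0 : ℝ),
    v ^ (ν / 2 - 1) * Real.exp (-v) / Real.Gamma (ν / 2) *
      nCdf (x * Real.sqrt (2 * v / ν) - a)

/-- Multivariate non-central t distribution function. -/
def mvnctCdf {ι : Type*} [Fintype ι] [DecidableEq ι]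
    (y : ι → ℝ) (S : Matrix ι ι ℝ) (κ : ι → ℝ) (ν : ℝ) : ℝ :=
  ∫ v in Set.Ioi (0 : ℝ),
    v ^ (ν / 2 - 1) * Real.exp (-v) / Real.Gamma (ν / 2) *
      mvnCdf S fun i => y i * Real.sqrt (2 * v / ν) - κ i

/-- Multivariate non-central t density (scale-mixture form). -/
def mvnctPdf {ι : Type*} [Fintype ι] [DecidableEq ι]
    (μ : ι → ℝ) (S : Matrix ι ι ℝ) (κ : ι → ℝ) (ν : ℝ) (y : ι → ℝ) : ℝ :=
  ∫ v in Set.Ioi (0 : ℝ),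
    v ^ (ν / 2 - 1) * Real.exp (-v) / Real.Gamma (ν / 2) *
      ((2 * v / ν) ^ ((Fintype.card ι : ℝ) / 2) *
        mvnPdf S fun i => Real.sqrt (2 * v / ν) * (y i - μ i) - κ i)

/-- Univariate non-central t density with location `μ`, scale (standard deviation) `s`,
non-centrality `κ` and `ν` degrees of freedom. -/
def nctPdf1 (μ s κ ν x : ℝ) : ℝ :=
  ∫ v in Set.Ioi (0 : ℝ),
    v ^ (ν / 2 - 1) * Real.exp (-v) / Real.Gamma (ν / 2) *
      (Real.sqrt (2 * v / ν) * s⁻¹ * nPdf (Real.sqrt (2 * v / ν) * (x - μ) / s - κ))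

/-- Non-central extended skew-t density. -/
def skewTPdf {ι : Type*} [Fintype ι] [DecidableEq ι]
    (μ : ι → ℝ) (Ω : Matrix ι ι ℝ) (α : ι → ℝ) (τ κ ν : ℝ) (y : ι → ℝ) : ℝ :=
  let d : ℝ := Fintype.card ι
  let ω : Matrix ι ι ℝ := Matrix.diagonal fun i => Real.sqrt (Ω i i)
  let Ωb : Matrix ι ι ℝ := ω⁻¹ * Ω * ω⁻¹
  let z : ι → ℝ := ω⁻¹.mulVec fun i => y i - μ i
  let Q : ℝ := α ⬝ᵥ Ωb.mulVec α
  tPdf Ω ν (fun i => y i - μ i) *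
      nctCdf ((α ⬝ᵥ z + τ) * Real.sqrt ((ν + d) / (ν + z ⬝ᵥ Ωb⁻¹.mulVec z))) κ (ν + d) /
    nctCdf (τ / Real.sqrt (1 + Q)) (κ / Real.sqrt (1 + Q)) ν

/-- Non-central extended skew-t distribution function. -/
def skewTCdf {ι : Type*} [Fintype ι] [DecidableEq ι]
    (μ : ι → ℝ) (Ω : Matrix ι ι ℝ) (α : ι → ℝ) (τ κ ν : ℝ) (y : ι → ℝ) : ℝ :=
  ∫ u in Set.univ.pi fun i => Set.Iic (y i), skewTPdf μ Ω α τ κ ν u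


open ProbabilityTheory

lemma aux_nPdf_eq (x : ℝ) : nPdf x = gaussianPDFReal 0 1 x := by
  simp [nPdf, gaussianPDFReal]

lemma aux_nPdf_fun : nPdf = gaussianPDFReal 0 1 := funext aux_nPdf_eq

lemma aux_nPdf_pos (x : ℝ) : 0 < nPdf x := by
  rw [aux_nPdf_eq]; exact gaussianPDFReal_pos _ _ _ one_ne_zero

lemma aux_nPdf_int : Integrable nPdf := by
  rw [aux_nPdf_fun]; exact integrable_gaussianPDFReal 0 1

lemma aux_nPdf_cont : Continuous nPdf := by
  unfold nPdf; fun_prop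

lemma aux_nCdf_eq (x : ℝ) : nCdf x = (gaussianReal 0 1).real (Set.Iio x) := by
  rw [nCdf, Measure.real, gaussianReal_apply_eq_integral _ one_ne_zero, aux_nPdf_fun,
    ENNReal.toReal_ofReal]
  exact integral_nonneg fun _ => gaussianPDFReal_nonneg _ _ _

lemma aux_nCdf_nonneg (x : ℝ) : 0 ≤ nCdf x := by
  rw [aux_nCdf_eq]; exact measureReal_nonneg

lemma aux_nCdf_le (x : ℝ) : nCdf x ≤ 1 := by
  rw [aux_nCdf_eq]; exact measureReal_le_one

lemma aux_nCdf_pos (x : ℝ) : 0 < nCdf x := by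
  unfold nCdf
  rw [setIntegral_pos_iff_support_of_nonneg_ae]
  · have : Function.support nPdf = Set.univ := by
      ext y; simp [(aux_nPdf_pos y).ne']
    simp [this]
  · exact Eventually.of_forall fun y => (aux_nPdf_pos y).le
  · exact aux_nPdf_int.integrableOn

lemma aux_nCdf_mono : Monotone nCdf := by
  intro x y h
  rw [aux_nCdf_eq, aux_nCdf_eq]
  exact measureReal_mono (Set.Iio_subset_Iio h)

lemma aux_nCdf_meas : Measurable nCdf := aux_nCdf_mono.measurable

lemma aux_one (σ c : ℝ) : ∫ x, nPdf x * nCdf (σ * x + c) = nCdf (c / Real.sqrt (1 + σ ^ 2)) := by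
  have h1 : ∫ x, nPdf x * nCdf (σ * x + c) = ∫ x, nCdf (σ * x + c) ∂(gaussianReal 0 1) := by
    rw [integral_gaussianReal_eq_integral_smul one_ne_zero]
    simp [aux_nPdf_eq]
  set γ := gaussianReal 0 1
  have hpos : (0:ℝ) < 1 + σ ^ 2 := by positivity
  have hconv : (γ.map (fun x => -σ * x)) ∗ γ = γ.map (fun x => Real.sqrt (1 + σ ^ 2) * x) := by
    rw [gaussianReal_map_const_mul, gaussianReal_map_const_mul, gaussianReal_conv_gaussianReal]
    congr 1
    · simp
    · ext; simp [Real.sq_sqrt hpos.le]; ring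
  have hm : MeasurableSet (Set.Iio c) := measurableSet_Iio
  have h2 : ((γ.map (fun x => -σ * x)) ∗ γ) (Set.Iio c) = ∫⁻ x, γ (Set.Iio (σ * x + c)) ∂γ := by
    rw [Measure.conv, Measure.map_apply (by fun_prop) hm,
      Measure.prod_apply (hm.preimage (by fun_prop)), lintegral_map]
    · congr 1; ext x; congr 1; ext u; simp
    · exact measurable_measure_prodMk_left (hm.preimage (by fun_prop))
    · fun_prop
  have h3 : (γ.map (fun x => Real.sqrt (1 + σ ^ 2) * x)) (Set.Iio c)
      = γ (Set.Iio (c / Real.sqrt (1 + σ ^ 2))) := by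
    rw [Measure.map_apply (by fun_prop) hm]
    congr 1; ext u
    simp only [Set.mem_preimage, Set.mem_Iio]
    rw [lt_div_iff₀ (Real.sqrt_pos.2 hpos), mul_comm]
  rw [h1, aux_nCdf_eq, Measure.real, ← h3, ← hconv, h2]
  simp_rw [aux_nCdf_eq]
  rw [← integral_toReal]
  · rfl
  · refine Measurable.aemeasurable ?_
    exact (Monotone.measurable (f := fun y => γ (Set.Iio y))
      (fun a b h => measure_mono (Set.Iio_subset_Iio h))).comp (by fun_prop)
  · exact Eventually.of_forall fun x => measure_lt_top _ _

lemma aux_one' (σ c t : ℝ) (ht : 0 < t) :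
    ∫ x, nPdf x * nCdf ((σ * x + c) / Real.sqrt t) = nCdf (c / Real.sqrt (t + σ ^ 2)) := by
  have := aux_one (σ / Real.sqrt t) (c / Real.sqrt t)
  have h : ∀ x, (σ * x + c) / Real.sqrt t = σ / Real.sqrt t * x + c / Real.sqrt t := by
    intro x; ring
  simp_rw [h, this]
  congr 1
  rw [div_div, ← Real.sqrt_mul ht.le, div_pow, Real.sq_sqrt ht.le]
  congr 2; field_simp

lemma aux_prod_int (d : ℕ) : Integrable (fun z : Fin d → ℝ => ∏ i, nPdf (z i)) :=
  Integrable.fintype_prod (f := fun _ => nPdf) (fun _ => aux_nPdf_int)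

lemma aux_prod_nonneg (d : ℕ) (z : Fin d → ℝ) : 0 ≤ ∏ i, nPdf (z i) :=
  Finset.prod_nonneg fun _ _ => (aux_nPdf_pos _).le

lemma aux_int (d : ℕ) (b : Fin d → ℝ) (c : ℝ) :
    Integrable (fun z : Fin d → ℝ => (∏ i, nPdf (z i)) * nCdf (b ⬝ᵥ z + c)) := by
  refine (aux_prod_int d).mul_bdd (c := 1) ?_ ?_
  · refine (aux_nCdf_meas.comp ?_).aestronglyMeasurable
    unfold dotProduct; fun_prop
  · refine Eventually.of_forall fun z => ?_
    rw [Real.norm_of_nonneg (aux_nCdf_nonneg _)]; exact aux_nCdf_le _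

lemma aux_multi (d : ℕ) (b : Fin d → ℝ) (c : ℝ) :
    ∫ z : Fin d → ℝ, (∏ i, nPdf (z i)) * nCdf (b ⬝ᵥ z + c)
      = nCdf (c / Real.sqrt (1 + b ⬝ᵥ b)) := by
  induction d generalizing c with
  | zero => simp [dotProduct, volume_pi, measureReal_def]
  | succ n ih =>
    have hmp := (volume_preserving_piFinSuccAbove (fun _ : Fin (n + 1) => ℝ) 0).symm
    have hi := aux_int (n+1) b c
    rw [← hmp.integrable_comp_emb (MeasurableEquiv.measurableEmbedding _)] at hi
    rw [← hmp.integral_comp']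
    rw [Measure.volume_eq_prod] at hi ⊢
    simp only [Function.comp_def] at hi
    rw [integral_prod _ hi]
    have e : ∀ (x : ℝ) (y : Fin n → ℝ),
        (∏ i, nPdf ((MeasurableEquiv.piFinSuccAbove (fun _ => ℝ) 0).symm (x, y) i)) *
          nCdf (b ⬝ᵥ ((MeasurableEquiv.piFinSuccAbove (fun _ => ℝ) 0).symm (x, y)) + c) =
        nPdf x * ((∏ i, nPdf (y i)) * nCdf ((fun i => b i.succ) ⬝ᵥ y + (b 0 * x + c))) := by
      intro x y
      simp [MeasurableEquiv.piFinSuccAbove, Fin.prod_univ_succ, dotProduct, Fin.sum_univ_succ,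
        mul_assoc]
      left; left; congr 1; ring
    simp_rw [e, integral_const_mul, ih]
    have hb : 0 ≤ (fun i : Fin n => b i.succ) ⬝ᵥ (fun i : Fin n => b i.succ) := by
      simp only [dotProduct]; exact Finset.sum_nonneg fun i _ => mul_self_nonneg _
    rw [aux_one' _ _ _ (by positivity)]
    congr 3
    simp [dotProduct, Fin.sum_univ_succ]; ring

/-- Gamma density. -/
def auxG (ν v : ℝ) : ℝ := v ^ (ν / 2 - 1) * Real.exp (-v) / Real.Gamma (ν / 2)

lemma auxG_int (ν : ℝ) (hν : 0 < ν) : IntegrableOn (auxG ν) (Set.Ioi 0) := by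
  have := (Real.GammaIntegral_convergent (s := ν / 2) (by positivity)).div_const (Real.Gamma (ν / 2))
  refine IntegrableOn.congr_fun this ?_ measurableSet_Ioi
  intro v _
  simp only [auxG]; ring

lemma auxG_pos (ν v : ℝ) (hν : 0 < ν) (hv : 0 < v) : 0 < auxG ν v := by
  have := Real.Gamma_pos_of_pos (s := ν / 2) (by positivity)
  unfold auxG; positivity

lemma auxG_meas (ν : ℝ) : Measurable (auxG ν) := by
  unfold auxG; fun_prop

lemma aux_nct_int (x a ν : ℝ) (hν : 0 < ν) :
    IntegrableOn (fun v => auxG ν v * nCdf (x * Real.sqrt (2 * v / ν) - a)) (Set.Ioi 0) := by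
  refine Integrable.mul_bdd (c := 1) (auxG_int ν hν) ?_ ?_
  · exact (aux_nCdf_meas.comp (by fun_prop)).aestronglyMeasurable
  · refine Eventually.of_forall fun z => ?_
    rw [Real.norm_of_nonneg (aux_nCdf_nonneg _)]; exact aux_nCdf_le _

lemma aux_nct_pos (x a ν : ℝ) (hν : 0 < ν) : 0 < nctCdf x a ν := by
  have hp : ∀ v ∈ Set.Ioi (0:ℝ), 0 < auxG ν v * nCdf (x * Real.sqrt (2 * v / ν) - a) :=
    fun v hv => mul_pos (auxG_pos ν v hν hv) (aux_nCdf_pos _)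
  change 0 < ∫ v in Set.Ioi (0:ℝ), auxG ν v * nCdf (x * Real.sqrt (2 * v / ν) - a)
  rw [setIntegral_pos_iff_support_of_nonneg_ae]
  · have : Function.support (fun v => auxG ν v * nCdf (x * Real.sqrt (2 * v / ν) - a)) ∩ Set.Ioi 0
        = Set.Ioi 0 := Set.inter_eq_right.2 fun v hv => (hp v hv).ne'
    rw [this]; simp
  · exact (ae_restrict_iff' measurableSet_Ioi).2 (Eventually.of_forall fun v hv => (hp v hv).le)
  · exact aux_nct_int x a ν hν

/-- Joint kernel. -/
def auxK (d : ℕ) (ν τ κ : ℝ) (b : Fin d → ℝ) (w : ℝ) (z : Fin d → ℝ) : ℝ :=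
  Real.sqrt (2 * w / ν) ^ d * ((∏ i, nPdf ((Real.sqrt (2 * w / ν) • z) i)) *
    nCdf (b ⬝ᵥ (Real.sqrt (2 * w / ν) • z) + (τ * Real.sqrt (2 * w / ν) - κ)))

lemma auxK_int (d : ℕ) (ν τ κ : ℝ) (b : Fin d → ℝ) (w : ℝ) (hw : 0 < w) (hν : 0 < ν) :
    Integrable (auxK d ν τ κ b w) := by
  have hs : 0 < Real.sqrt (2 * w / ν) := by positivity
  unfold auxK
  exact ((aux_int d b (τ * Real.sqrt (2 * w / ν) - κ)).comp_smul hs.ne').const_mul _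

lemma auxK_nonneg (d : ℕ) (ν τ κ : ℝ) (b : Fin d → ℝ) (w : ℝ) (z : Fin d → ℝ) :
    0 ≤ auxK d ν τ κ b w z :=
  mul_nonneg (by positivity) (mul_nonneg (aux_prod_nonneg d _) (aux_nCdf_nonneg _))

lemma auxK_integral (d : ℕ) (ν τ κ : ℝ) (b : Fin d → ℝ) (w : ℝ) (hw : 0 < w) (hν : 0 < ν) :
    ∫ z, auxK d ν τ κ b w z
      = nCdf ((τ / Real.sqrt (1 + b ⬝ᵥ b)) * Real.sqrt (2 * w / ν) - κ / Real.sqrt (1 + b ⬝ᵥ b)) := by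
  have hs : 0 < Real.sqrt (2 * w / ν) := by positivity
  unfold auxK
  rw [integral_const_mul, Measure.integral_comp_smul volume
    (fun u => (∏ i, nPdf (u i)) * nCdf (b ⬝ᵥ u + (τ * Real.sqrt (2 * w / ν) - κ))), aux_multi]
  rw [Module.finrank_fin_fun, abs_of_pos (by positivity), smul_eq_mul, ← mul_assoc,
    mul_inv_cancel₀ (by positivity), one_mul]
  congr 1; ring

lemma auxK_meas (d : ℕ) (ν τ κ : ℝ) (b : Fin d → ℝ) :
    Measurable (fun p : ℝ × (Fin d → ℝ) => auxK d ν τ κ b p.1 p.2) := by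
  have := aux_nPdf_cont.measurable
  unfold auxK
  refine Measurable.mul (by fun_prop) (Measurable.mul ?_ (aux_nCdf_meas.comp ?_))
  · simp only [Pi.smul_apply, smul_eq_mul]
    fun_prop
  · simp only [dotProduct, Pi.smul_apply, smul_eq_mul]
    fun_prop

lemma aux_joint (d : ℕ) (ν τ κ : ℝ) (b : Fin d → ℝ) (hν : 0 < ν) :
    Integrable (fun p : ℝ × (Fin d → ℝ) => auxG ν p.1 * auxK d ν τ κ b p.1 p.2)
      ((volume.restrict (Set.Ioi 0)).prod volume) := by
  rw [integrable_prod_iff]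
  · constructor
    · refine (ae_restrict_iff' measurableSet_Ioi).2 (Eventually.of_forall fun w hw => ?_)
      exact (auxK_int d ν τ κ b w hw hν).const_mul (auxG ν w)
    · have := aux_nct_int (τ / Real.sqrt (1 + b ⬝ᵥ b)) (κ / Real.sqrt (1 + b ⬝ᵥ b)) ν hν
      refine IntegrableOn.congr_fun this ?_ measurableSet_Ioi
      intro w hw
      have hw : 0 < w := hw
      have e : ∀ z, ‖auxG ν w * auxK d ν τ κ b w z‖ = auxG ν w * auxK d ν τ κ b w z := fun z =>
        Real.norm_of_nonneg (mul_nonneg (auxG_pos ν w hν hw).le (auxK_nonneg _ _ _ _ _ _ _))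
      simp only [e]
      rw [integral_const_mul, auxK_integral d ν τ κ b w hw hν]
  · exact (((auxG_meas ν).comp measurable_fst).mul (auxK_meas d ν τ κ b)).aestronglyMeasurable

lemma aux_swap (d : ℕ) (ν τ κ : ℝ) (b : Fin d → ℝ) (hν : 0 < ν) :
    ∫ z : Fin d → ℝ, ∫ w in Set.Ioi (0:ℝ), auxG ν w * auxK d ν τ κ b w z
      = nctCdf (τ / Real.sqrt (1 + b ⬝ᵥ b)) (κ / Real.sqrt (1 + b ⬝ᵥ b)) ν := by
  rw [← integral_integral_swap (f := fun w z => auxG ν w * auxK d ν τ κ b w z)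
    (aux_joint d ν τ κ b hν)]
  change _ = ∫ v in Set.Ioi (0:ℝ), auxG ν v * _
  refine setIntegral_congr_fun measurableSet_Ioi fun w hw => ?_
  rw [integral_const_mul, auxK_integral d ν τ κ b w hw hν]

lemma aux_prod_exp (d : ℕ) (z : Fin d → ℝ) (s : ℝ) :
    ∏ i, nPdf ((s • z) i) = ((Real.sqrt (2 * π))⁻¹) ^ d * Real.exp (- (s ^ 2 * (z ⬝ᵥ z)) / 2) := by
  simp only [nPdf, Finset.prod_mul_distrib, ← Real.exp_sum, dotProduct]
  simp only [Finset.prod_const, Finset.card_univ, Fintype.card_fin]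
  congr 2
  rw [Finset.mul_sum, ← Finset.sum_neg_distrib, Finset.sum_div]
  refine Finset.sum_congr rfl fun i _ => ?_
  simp; ring

lemma aux_pointwise (d : ℕ) (ν τ κ : ℝ) (b z : Fin d → ℝ) (hν : 0 < ν) :
    Real.Gamma ((ν + d) / 2) * (1 + z ⬝ᵥ z / ν) ^ (-(ν + d) / 2) /
      (Real.Gamma (ν / 2) * (ν * π) ^ ((d : ℝ) / 2)) *
      nctCdf ((b ⬝ᵥ z + τ) * Real.sqrt ((ν + d) / (ν + z ⬝ᵥ z))) κ (ν + d)
    = ∫ w in Set.Ioi (0:ℝ), auxG ν w * auxK d ν τ κ b w z := by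
  have hq : 0 ≤ z ⬝ᵥ z := by
    simp only [dotProduct]; exact Finset.sum_nonneg fun i _ => mul_self_nonneg _
  set q := z ⬝ᵥ z with hqdef
  have hr : 0 < 1 + q / ν := by positivity
  have hG := Real.Gamma_pos_of_pos (s := ν / 2) (by positivity)
  have hG' := Real.Gamma_pos_of_pos (s := (ν + d) / 2) (by positivity)
  unfold nctCdf
  have := integral_comp_mul_left_Ioi' (fun v : ℝ => v ^ ((ν + d) / 2 - 1) * Real.exp (-v) / Real.Gamma ((ν + d) / 2) *
      nCdf ((b ⬝ᵥ z + τ) * Real.sqrt ((ν + d) / (ν + q)) * Real.sqrt (2 * v / (ν + d)) - κ)) 0 hr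
  rw [mul_zero] at this
  rw [← this, smul_eq_mul, ← integral_const_mul, ← integral_const_mul]
  refine setIntegral_congr_fun measurableSet_Ioi fun w hw => ?_
  have hw : 0 < w := hw
  simp only [auxG, auxK, aux_prod_exp]
  have h1 : (b ⬝ᵥ z + τ) * Real.sqrt ((ν + d) / (ν + q)) *
      Real.sqrt (2 * ((1 + q / ν) * w) / (ν + d)) - κ
      = b ⬝ᵥ (Real.sqrt (2 * w / ν) • z) + (τ * Real.sqrt (2 * w / ν) - κ) := by
    rw [mul_assoc, ← Real.sqrt_mul (by positivity)]
    have : (ν + d) / (ν + q) * (2 * ((1 + q / ν) * w) / (ν + d)) = 2 * w / ν := by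
      have : ν + d ≠ 0 := by positivity
      have : ν + q ≠ 0 := by positivity
      field_simp
    rw [this, dotProduct_smul, smul_eq_mul]; ring
  rw [h1, ← hqdef, Real.sq_sqrt (by positivity)]
  have h2 : Real.exp (-((1 + q / ν) * w)) = Real.exp (-w) * Real.exp (-(2 * w / ν * q) / 2) := by
    rw [← Real.exp_add]; congr 1; field_simp; ring
  have h3 : ((1 + q / ν) * w) ^ ((ν + d) / 2 - 1) = (1 + q / ν) ^ ((ν + d) / 2) * (1 + q / ν)⁻¹ *
      (w ^ (ν / 2 - 1) * w ^ ((d : ℝ) / 2)) := by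
    rw [Real.mul_rpow hr.le hw.le, ← Real.rpow_add hw, Real.rpow_sub_one hr.ne', div_eq_mul_inv]
    congr 2; ring
  have h4 : (1 + q / ν) ^ (-(ν + d) / 2) = ((1 + q / ν) ^ ((ν + d) / 2))⁻¹ := by
    rw [neg_div, Real.rpow_neg hr.le]
  have h5 : Real.sqrt (2 * w / ν) ^ d * (Real.sqrt (2 * π))⁻¹ ^ d
      = w ^ ((d : ℝ) / 2) * ((ν * π) ^ ((d : ℝ) / 2))⁻¹ := by
    rw [← mul_pow, ← Real.sqrt_inv, ← Real.sqrt_mul (by positivity), Real.sqrt_eq_rpow,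
      ← Real.rpow_natCast, ← Real.rpow_mul (by positivity), ← Real.inv_rpow (by positivity),
      ← Real.mul_rpow (by positivity) (by positivity)]
    congr 1
    · field_simp
    · ring
  rw [h2, h3, h4]
  have hA : 0 < (1 + q / ν) ^ ((ν + d) / 2) := by positivity
  generalize (1 + q / ν) ^ ((ν + d) / 2) = A at hA
  generalize nCdf _ = N
  have hP : 0 < (ν * π) ^ ((d : ℝ) / 2) := by positivity
  calc _ = w ^ (ν / 2 - 1) * Real.exp (-w) / Real.Gamma (ν / 2) *
        ((w ^ ((d : ℝ) / 2) * ((ν * π) ^ ((d : ℝ) / 2))⁻¹) *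
          Real.exp (-(2 * w / ν * q) / 2) * N) := by
        generalize (1 + q / ν) = r at *
        generalize (ν * π) ^ ((d : ℝ) / 2) = P at *
        generalize Real.exp (-(2 * w / ν * q) / 2) = E1
        generalize w ^ ((d : ℝ) / 2) = W
        field_simp
    _ = _ := by rw [← h5]; ring

lemma aux_core (d : ℕ) (ν τ κ : ℝ) (b : Fin d → ℝ) (hν : 0 < ν) :
    ∫ z : Fin d → ℝ, Real.Gamma ((ν + d) / 2) * (1 + z ⬝ᵥ z / ν) ^ (-(ν + d) / 2) /
      (Real.Gamma (ν / 2) * (ν * π) ^ ((d : ℝ) / 2)) *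
      nctCdf ((b ⬝ᵥ z + τ) * Real.sqrt ((ν + d) / (ν + z ⬝ᵥ z))) κ (ν + d)
    = nctCdf (τ / Real.sqrt (1 + b ⬝ᵥ b)) (κ / Real.sqrt (1 + b ⬝ᵥ b)) ν := by
  simp_rw [aux_pointwise d ν τ κ b _ hν]
  exact aux_swap d ν τ κ b hν

lemma aux_change (d : ℕ) (M : Matrix (Fin d) (Fin d) ℝ) (hM : M.det ≠ 0) (f : (Fin d → ℝ) → ℝ) :
    ∫ x, f x = |M.det| * ∫ z, f (M *ᵥ z) := by
  have hinj : Function.Injective (M *ᵥ ·) := Matrix.mulVec_injective_of_isUnit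
    ((Matrix.isUnit_iff_isUnit_det M).2 hM.isUnit)
  have hemb : MeasurableEmbedding (Matrix.toLin' M) := by
    refine Continuous.measurableEmbedding ?_ hinj
    exact LinearMap.continuous_of_finiteDimensional _
  have h := hemb.integral_map (μ := volume) f
  rw [Real.map_matrix_volume_pi_eq_smul_volume_pi hM, integral_smul_measure,
    ENNReal.toReal_ofReal (abs_nonneg _), abs_inv, smul_eq_mul] at h
  simp only [Matrix.toLin'_apply] at h
  rw [← h, ← mul_assoc, mul_inv_cancel₀ (abs_pos.2 hM).ne', one_mul]

open scoped MatrixOrder in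
lemma aux_factor (d : ℕ) (Ω : Matrix (Fin d) (Fin d) ℝ) (hΩ : Ω.PosDef) :
    ∃ B : Matrix (Fin d) (Fin d) ℝ, Ω = Bᵀ * B ∧ B.det ≠ 0 := by
  obtain ⟨B, hB⟩ := CStarAlgebra.nonneg_iff_eq_star_mul_self.mp hΩ.posSemidef.nonneg
  have hB' : Ω = Bᵀ * B := by simpa [Matrix.star_eq_conjTranspose] using hB
  refine ⟨B, hB', fun h => ?_⟩
  have := hΩ.det_pos
  rw [hB', Matrix.det_mul, h, mul_zero] at this
  exact lt_irrefl _ this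

lemma aux_first
    (d : ℕ) (μ : Fin d → ℝ) (Ω : Matrix (Fin d) (Fin d) ℝ) (hΩ : Ω.PosDef)
    (α : Fin d → ℝ) (τ κ ν : ℝ) (hν : 0 < ν) (ω Ωb : Matrix (Fin d) (Fin d) ℝ)
    (hω : ω = Matrix.diagonal fun i => Real.sqrt (Ω i i)) (hΩb : Ωb = ω⁻¹ * Ω * ω⁻¹) :
    (∫ y : Fin d → ℝ,
        tPdf Ω ν (fun i => y i - μ i) *
          nctCdf ((α ⬝ᵥ ω⁻¹.mulVec (fun i => y i - μ i) + τ) *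
              Real.sqrt ((ν + d) /
                (ν + ω⁻¹.mulVec (fun i => y i - μ i) ⬝ᵥ
                  Ωb⁻¹.mulVec (ω⁻¹.mulVec fun i => y i - μ i))))
            κ (ν + d)) =
      nctCdf (τ / Real.sqrt (1 + α ⬝ᵥ Ωb.mulVec α))
        (κ / Real.sqrt (1 + α ⬝ᵥ Ωb.mulVec α)) ν := by
  obtain ⟨B, hB, hdet⟩ := aux_factor d Ω hΩ
  have hωdet : IsUnit ω.det := by
    rw [hω, Matrix.det_diagonal]
    refine IsUnit.mk0 _ (Finset.prod_ne_zero_iff.2 fun i _ => ?_)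
    exact (Real.sqrt_pos.2 hΩ.diag_pos).ne'
  have hωT : ωᵀ = ω := by rw [hω, Matrix.diagonal_transpose]
  have hωiT : (ω⁻¹)ᵀ = ω⁻¹ := by rw [Matrix.transpose_nonsing_inv, hωT]
  have hBu : IsUnit B.det := hdet.isUnit
  have hBTu : IsUnit Bᵀ.det := by rwa [Matrix.det_transpose]
  have hΩbi : Ωb⁻¹ = ω * Ω⁻¹ * ω := by
    rw [hΩb, Matrix.mul_inv_rev, Matrix.mul_inv_rev, Matrix.nonsing_inv_nonsing_inv _ hωdet,
      Matrix.mul_assoc]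
  have hΩi : Ω⁻¹ = B⁻¹ * (Bᵀ)⁻¹ := by rw [hB, Matrix.mul_inv_rev]
  set b : Fin d → ℝ := B *ᵥ (ω⁻¹ *ᵥ α) with hb
  have hq : ∀ z : Fin d → ℝ, (Bᵀ *ᵥ z) ⬝ᵥ Ω⁻¹ *ᵥ (Bᵀ *ᵥ z) = z ⬝ᵥ z := by
    intro z
    rw [Matrix.mulVec_mulVec, hΩi, Matrix.mul_assoc, Matrix.nonsing_inv_mul _ hBTu, Matrix.mul_one,
      Matrix.mulVec_transpose, ← Matrix.dotProduct_mulVec, Matrix.mulVec_mulVec,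
      Matrix.mul_nonsing_inv _ hBu, Matrix.one_mulVec]
  have hq2 : ∀ x : Fin d → ℝ, (ω⁻¹ *ᵥ x) ⬝ᵥ Ωb⁻¹ *ᵥ (ω⁻¹ *ᵥ x) = x ⬝ᵥ Ω⁻¹ *ᵥ x := by
    intro x
    rw [hΩbi, Matrix.mulVec_mulVec, Matrix.mul_assoc, Matrix.mul_nonsing_inv _ hωdet,
      Matrix.mul_one, ← Matrix.mulVec_mulVec]
    nth_rw 1 [← hωiT]
    rw [Matrix.mulVec_transpose, ← Matrix.dotProduct_mulVec, Matrix.mulVec_mulVec,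
      Matrix.nonsing_inv_mul _ hωdet, Matrix.one_mulVec]
  have hl : ∀ z : Fin d → ℝ, α ⬝ᵥ ω⁻¹ *ᵥ (Bᵀ *ᵥ z) = b ⬝ᵥ z := by
    intro z
    rw [hb, Matrix.dotProduct_mulVec, ← Matrix.mulVec_transpose, hωiT, Matrix.dotProduct_mulVec,
      Matrix.vecMul_transpose]
  have hbb : b ⬝ᵥ b = α ⬝ᵥ Ωb *ᵥ α := by
    rw [← hl, hb, hΩb, hB]
    simp only [Matrix.mulVec_mulVec, Matrix.mul_assoc]
  have hdetΩ : Real.sqrt Ω.det = |B.det| := by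
    rw [hB, Matrix.det_mul, Matrix.det_transpose, Real.sqrt_mul_self_eq_abs]
  refine Eq.trans (integral_sub_right_eq_self (fun x : Fin d → ℝ => tPdf Ω ν x *
          nctCdf ((α ⬝ᵥ ω⁻¹.mulVec x + τ) *
              Real.sqrt ((ν + d) / (ν + ω⁻¹.mulVec x ⬝ᵥ Ωb⁻¹.mulVec (ω⁻¹.mulVec x)))) κ (ν + d)) μ) ?_
  rw [aux_change d Bᵀ (by rwa [Matrix.det_transpose]), ← integral_const_mul, ← hbb,
    ← aux_core d ν τ κ b hν]
  congr 1
  ext z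
  rw [hq2, hq, hl, tPdf, hq, hdetΩ, Matrix.det_transpose, Fintype.card_fin]
  have : |B.det| ≠ 0 := (abs_pos.2 hdet).ne'
  field_simp

/-- the non-central extended skew-t density integrates to one. -/
theorem skewT_integrates_to_one
    (d : ℕ) (μ : Fin d → ℝ) (Ω : Matrix (Fin d) (Fin d) ℝ) (hΩ : Ω.PosDef)
    (α : Fin d → ℝ) (τ κ ν : ℝ) (hν : 0 < ν) :
    let ω : Matrix (Fin d) (Fin d) ℝ := Matrix.diagonal fun i => Real.sqrt (Ω i i)
    let Ωb : Matrix (Fin d) (Fin d) ℝ := ω⁻¹ * Ω * ω⁻¹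
    (∫ y : Fin d → ℝ,
        tPdf Ω ν (fun i => y i - μ i) *
          nctCdf ((α ⬝ᵥ ω⁻¹.mulVec (fun i => y i - μ i) + τ) *
              Real.sqrt ((ν + d) /
                (ν + ω⁻¹.mulVec (fun i => y i - μ i) ⬝ᵥ
                  Ωb⁻¹.mulVec (ω⁻¹.mulVec fun i => y i - μ i))))
            κ (ν + d)) =
      nctCdf (τ / Real.sqrt (1 + α ⬝ᵥ Ωb.mulVec α))
        (κ / Real.sqrt (1 + α ⬝ᵥ Ωb.mulVec α)) ν ∧
    (∫ y : Fin d → ℝ, skewTPdf μ Ω α τ κ ν y) = 1 := by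
  intro ω Ωb
  have h1 := aux_first d μ Ω hΩ α τ κ ν hν ω Ωb rfl rfl
  refine ⟨h1, ?_⟩
  have h2 : ∀ y, skewTPdf μ Ω α τ κ ν y = tPdf Ω ν (fun i => y i - μ i) *
          nctCdf ((α ⬝ᵥ ω⁻¹.mulVec (fun i => y i - μ i) + τ) *
              Real.sqrt ((ν + d) /
                (ν + ω⁻¹.mulVec (fun i => y i - μ i) ⬝ᵥ
                  Ωb⁻¹.mulVec (ω⁻¹.mulVec fun i => y i - μ i))))
            κ (ν + d) / nctCdf (τ / Real.sqrt (1 + α ⬝ᵥ Ωb.mulVec α))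
        (κ / Real.sqrt (1 + α ⬝ᵥ Ωb.mulVec α)) ν := by
    intro y
    simp only [skewTPdf, Fintype.card_fin]
    rfl
  simp_rw [h2]
  rw [integral_div, h1]
  exact div_self (aux_nct_pos _ _ _ hν).ne'
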